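/- The directional Haar filter bank {τ₀,…,τ₆} satisfies the partition of unity condition: Σ_{ℓ=0}^6 |τ̂ℓ(ξ)|² = 1 for all ξ ∈ ℝ². -/

import Mathlib

open scoped BigOperators

/-- The directional Haar filters, as 2×2 matrices of coefficients indexed by `{0,1}²`. -/
noncomputable def dhfFilter : Fin 7 → Matrix (Fin 2) (Fin 2) ℝ :=
  ![!![1/4, 1/4; 1/4, 1/4],
    !![1/4, 0; 0, -1/4],
    !![0, -1/4; 1/4, 0],
    !![1/4, -1/4; 0, 0],
    !![1/4, 0; -1/4, 0],
    !![0, 0; 1/4, -1/4],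
    !![0, 1/4; 0, -1/4]]

/-- Fourier series of a filter supported on `{0,1}²`: `τ̂(ξ) = Σ_k τ(k) e^{-i k·ξ}`. -/
noncomputable def dhfFourier (τ : Matrix (Fin 2) (Fin 2) ℝ) (ξ : ℝ × ℝ) : ℂ :=
  ∑ k₁ : Fin 2, ∑ k₂ : Fin 2,
    (τ k₁ k₂ : ℂ) * Complex.exp (-Complex.I * (((k₁ : ℕ) : ℝ) * ξ.1 + ((k₂ : ℕ) : ℝ) * ξ.2))

lemma dhf_normSq (t : ℂ) (h : ‖t‖ = 1) : t.re * t.re + t.im * t.im = 1 := by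
  have := Complex.normSq_eq_norm_sq t
  rw [h, Complex.normSq_apply] at this
  simpa using this

lemma dhf_exp (x y : ℝ) : ‖Complex.exp (-Complex.I * ((x : ℂ) + (y : ℂ)))‖ = 1 := by
  rw [Complex.norm_exp]
  simp

lemma dhf_alg (E : Fin 2 → Fin 2 → ℂ) (hE : ∀ i j, ‖E i j‖ = 1) :
    ∑ l : Fin 7, ‖∑ i : Fin 2, ∑ j : Fin 2, (dhfFilter l i j : ℂ) * E i j‖ ^ 2 = 1 := by
  have h00 := dhf_normSq _ (hE 0 0)
  have h01 := dhf_normSq _ (hE 0 1)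
  have h10 := dhf_normSq _ (hE 1 0)
  have h11 := dhf_normSq _ (hE 1 1)
  simp only [← Complex.normSq_eq_norm_sq, Complex.normSq_apply, Complex.add_re, Complex.add_im,
    Complex.re_ofReal_mul, Complex.im_ofReal_mul, Fin.sum_univ_two]
  simp [Fin.sum_univ_succ, dhfFilter]
  linear_combination (h00 + h01 + h10 + h11) / 4

/-- Partition of unity for the directional Haar filter bank:
`Σ_{ℓ=0}^6 |τ̂ℓ(ξ)|² = 1` for all `ξ ∈ ℝ²`. -/
theorem dhf_partition_of_unity :
    ∀ ξ : ℝ × ℝ, ∑ ℓ : Fin 7, ‖dhfFourier (dhfFilter ℓ) ξ‖ ^ 2 = 1 := by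
  intro ξ
  refine dhf_alg (fun k₁ k₂ => Complex.exp
    (-Complex.I * (((k₁ : ℕ) : ℝ) * ξ.1 + ((k₂ : ℕ) : ℝ) * ξ.2))) (fun i j => ?_)
  have := dhf_exp (((i : ℕ) : ℝ) * ξ.1) (((j : ℕ) : ℝ) * ξ.2)
  push_cast at this ⊢
  exact this
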